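/- Let W be an H-module algebra satisfying the t-th Capelli identity (every multilinear H-polynomial alternating in t variables is an H-identity of W). Then the relatively free H-module algebra 𝒲 on t−1 generators, 𝒲 = F^H⟨x₁,...,x_{t−1}⟩ / (id^H(W) ∩ F^H⟨x₁,...,x_{t−1}⟩), satisfies id^H(𝒲) = id^H(W). -/

import Mathlib

noncomputable section
open TensorProduct

/-! ## The free `H`-module algebra -/

variable (F : Type) [Field F] (H : Type) [Ring H] [Algebra F H]

/-- The free `H`-module algebra `F^H⟨X⟩` on a set of variables `V`:
the tensor algebra on `F X ⊗ H`. -/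
abbrev FreeHMA (V : Type) : Type := TensorAlgebra F ((V →₀ F) ⊗[F] H)

variable {V : Type}

/-- The variable `x_v^h`. -/
def xvar (v : V) (h : H) : FreeHMA F H V :=
  TensorAlgebra.ι F (Finsupp.single v 1 ⊗ₜ[F] h)

/-- The algebra endomorphism of the free `H`-module algebra induced by a linear
substitution of the variables (not touching the `H`-labels). -/
def substHom (g : V → (V →₀ F)) : FreeHMA F H V →ₐ[F] FreeHMA F H V :=
  TensorAlgebra.lift F ((TensorAlgebra.ι F).comp
    (LinearMap.rTensor H (Finsupp.linearCombination F g)))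

/-- `f|_{x_i ↔ x_j}` : swapping two variables. -/
def swapSubst [DecidableEq V] (i j : V) : FreeHMA F H V →ₐ[F] FreeHMA F H V :=
  substHom F H (fun v => Finsupp.single (Equiv.swap i j v) 1)

/-- `f|_{x_i → x_j}` : substituting `x_j` for `x_i`. -/
def renameSubst [DecidableEq V] (i j : V) : FreeHMA F H V →ₐ[F] FreeHMA F H V :=
  substHom F H (Function.update (fun v => Finsupp.single v 1) i (Finsupp.single j 1))

/-- `f` is alternating on the set of variables `X`. -/
def AlternatingOn [DecidableEq V] (X : Finset V) (f : FreeHMA F H V) : Prop :=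
  ∀ i ∈ X, ∀ j ∈ X, i ≠ j → swapSubst F H i j f = -f

/-- `f` involves only variables from `T`. -/
def DependsOnlyOn (f : FreeHMA F H V) (T : Set V) : Prop :=
  f ∈ Algebra.adjoin F {x : FreeHMA F H V | ∃ v ∈ T, ∃ h : H, x = xvar F H v h}

/-- `f` is a multilinear `H`-polynomial in the variables of `supp` (and involves no
other variables): substituting `α x_i + y` for `x_i` (`y` a fresh variable) gives
`α f + f|_{x_i → y}`. -/
def MultilinearOn [DecidableEq V] (supp S : Finset V) (f : FreeHMA F H V) : Prop :=
  DependsOnlyOn F H f ↑supp ∧ S ⊆ supp ∧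
  ∀ i ∈ S, ∀ y, y ∉ supp → ∀ α : F,
    substHom F H (Function.update (fun v => Finsupp.single v 1) i
        (α • Finsupp.single i 1 + Finsupp.single y 1)) f
      = α • f + renameSubst F H i y f

/-! ## `H`-module algebras -/

variable [Coalgebra F H]

/-- An `H`-module algebra structure on an `F`-algebra `A`: an `H`-action by linear maps
such that `h·(ab) = (h₍₁₎·a)(h₍₂₎·b)` and `h·1 = ε(h)1`. -/
structure HMA (A : Type) [Ring A] [Algebra F A] where
  act : H →ₗ[F] A →ₗ[F] A
  act_one : act 1 = LinearMap.id
  act_mul : ∀ h k : H, act (h * k) = (act h).comp (act k)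
  act_algebraOne : ∀ h : H, act h 1 = (Coalgebra.counit (R := F) h) • (1 : A)
  act_mul_compat :
    (TensorProduct.lift act).comp ((LinearMap.mul' F A).lTensor H)
      = (LinearMap.mul' F A).comp
          (((TensorProduct.map (TensorProduct.lift act) (TensorProduct.lift act)).comp
            (TensorProduct.tensorTensorTensorComm F H H A A).toLinearMap).comp
            ((Coalgebra.comul (R := F) (A := H)).rTensor (A ⊗[F] A)))

variable {A : Type} [Ring A] [Algebra F A]

/-- Evaluation of `H`-polynomials at an assignment `v : V → A` of the variables,
sending `x_v^h` to `h · (v v)`. -/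
def HMA.eval (M : HMA F H A) (v : V → A) : FreeHMA F H V →ₐ[F] A :=
  TensorAlgebra.lift F
    (TensorProduct.lift ((M.act.flip).comp (Finsupp.linearCombination F v)))

/-- The set of `H`-identities of `A` (in variables `V`). -/
def HMA.idSet (M : HMA F H A) (V : Type) : Set (FreeHMA F H V) :=
  {f | ∀ v : V → A, M.eval F H v f = 0}

/-- The `F`-subspace of `H`-identities of `A`. -/
def HMA.idSub (M : HMA F H A) (V : Type) : Submodule F (FreeHMA F H V) :=
  ⨅ v : V → A, LinearMap.ker (M.eval F H v).toLinearMap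

/-! ## `H`-T-ideals -/

/-- The canonical `H`-module algebra structure on the free `H`-module algebra is
characterized by `h · x_v^k = x_v^{hk}` on generators. -/
def IsFreeAction (𝔉 : HMA F H (FreeHMA F H V)) : Prop :=
  ∀ (h k : H) (p : V →₀ F),
    𝔉.act h (TensorAlgebra.ι F (p ⊗ₜ[F] k)) = TensorAlgebra.ι F (p ⊗ₜ[F] (h * k))

/-- An `H`-T-ideal: a two-sided ideal of the free `H`-module algebra stable under all
`H`-endomorphisms, i.e. under all substitutions of the variables by arbitrary
`H`-polynomials (`𝔉` is the free `H`-action). -/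
def IsHTIdeal (𝔉 : HMA F H (FreeHMA F H V)) (Γ : Set (FreeHMA F H V)) : Prop :=
  (0 : FreeHMA F H V) ∈ Γ ∧
  (∀ f g, f ∈ Γ → g ∈ Γ → f + g ∈ Γ) ∧
  (∀ f g, f ∈ Γ → g * f ∈ Γ ∧ f * g ∈ Γ) ∧
  (∀ (v : V → FreeHMA F H V) f, f ∈ Γ → 𝔉.eval F H v f ∈ Γ)

/-- The `H`-T-ideal generated by a set of `H`-polynomials. -/
def hTIdealSpan (𝔉 : HMA F H (FreeHMA F H V)) (s : Set (FreeHMA F H V)) :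
    Set (FreeHMA F H V) :=
  ⋂₀ {Γ | IsHTIdeal F H 𝔉 Γ ∧ s ⊆ Γ}

/-- `Γ` contains the `t`-th Capelli identity: every multilinear `H`-polynomial
alternating in `t` variables belongs to `Γ`. -/
def SatisfiesCapelli (Γ : Set (FreeHMA F H ℕ)) (t : ℕ) : Prop :=
  ∀ (f : FreeHMA F H ℕ) (supp X : Finset ℕ),
    MultilinearOn F H supp supp f → X ⊆ supp → X.card = t → AlternatingOn F H X f → f ∈ Γ

/-! ## The Kemer index -/

/-- There are, for every `μ`, multilinear `H`-polynomials outside `Γ` alternating on `μ`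
disjoint (small) sets of cardinality `a` and on `s` further disjoint (big) sets of
cardinality `a+1`. -/
def HasKemerAlt (Γ : Set (FreeHMA F H ℕ)) (a s : ℕ) : Prop :=
  ∀ μ : ℕ, ∃ (supp : Finset ℕ) (f : FreeHMA F H ℕ)
      (Xs : Fin μ → Finset ℕ) (Ys : Fin s → Finset ℕ),
    f ∉ Γ ∧ MultilinearOn F H supp supp f ∧
    (∀ i, Xs i ⊆ supp) ∧ (∀ j, Ys j ⊆ supp) ∧
    (∀ i, (Xs i).card = a) ∧ (∀ j, (Ys j).card = a + 1) ∧
    Pairwise (fun i i' => Disjoint (Xs i) (Xs i')) ∧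
    Pairwise (fun j j' => Disjoint (Ys j) (Ys j')) ∧
    (∀ i j, Disjoint (Xs i) (Ys j)) ∧
    (∀ i, AlternatingOn F H (Xs i) f) ∧ (∀ j, AlternatingOn F H (Ys j) f)

/-- `α(Γ)`, the first component of the Kemer index. -/
def kemerAlpha (Γ : Set (FreeHMA F H ℕ)) : ℕ :=
  sSup {a | HasKemerAlt F H Γ a 0}

/-- `s(Γ)`, the second component of the Kemer index. -/
def kemerS (Γ : Set (FreeHMA F H ℕ)) : ℕ :=
  sSup {s | HasKemerAlt F H Γ (kemerAlpha F H Γ) s}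

/-- The Kemer index `Ind(Γ) = (α(Γ), s(Γ))`. -/
def kemerIndex (Γ : Set (FreeHMA F H ℕ)) : ℕ × ℕ :=
  (kemerAlpha F H Γ, kemerS F H Γ)

/-- An `H`-Kemer polynomial of `Γ` of rank `μ`. -/
def IsKemerPoly (Γ : Set (FreeHMA F H ℕ)) (μ : ℕ) (f : FreeHMA F H ℕ) : Prop :=
  ∃ (supp : Finset ℕ) (Xs : Fin μ → Finset ℕ)
      (Ys : Fin (kemerS F H Γ) → Finset ℕ),
    f ∉ Γ ∧ MultilinearOn F H supp supp f ∧
    (∀ i, Xs i ⊆ supp) ∧ (∀ j, Ys j ⊆ supp) ∧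
    (∀ i, (Xs i).card = kemerAlpha F H Γ) ∧
    (∀ j, (Ys j).card = kemerAlpha F H Γ + 1) ∧
    Pairwise (fun i i' => Disjoint (Xs i) (Xs i')) ∧
    Pairwise (fun j j' => Disjoint (Ys j) (Ys j')) ∧
    (∀ i j, Disjoint (Xs i) (Ys j)) ∧
    (∀ i, AlternatingOn F H (Xs i) f) ∧ (∀ j, AlternatingOn F H (Ys j) f)

/-! ## Finite dimensional `H`-module algebras, radicals and parameters -/

/-- A bundled finite dimensional `H`-module algebra. -/
structure FDHMA where
  carrier : Type
  [ring : Ring carrier]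
  [alg : Algebra F carrier]
  fd : FiniteDimensional F carrier
  M : HMA F H carrier

attribute [instance] FDHMA.ring FDHMA.alg

/-- The Jacobson radical of an `F`-algebra, as an `F`-subspace. -/
def jacRad (A : Type) [Ring A] [Algebra F A] : Submodule F A :=
  ((⊥ : Ideal A).jacobson).restrictScalars F

/-- The nilpotency index `n_A` of the Jacobson radical. -/
def nilIndex (A : Type) [Ring A] : ℕ :=
  sInf {n : ℕ | ((⊥ : Ideal A).jacobson) ^ n = ⊥}

/-- `d(A)`, the dimension of the semisimple part `A/J(A)`. -/
def ssDim (A : Type) [Ring A] [Algebra F A] : ℕ :=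
  Module.finrank F (A ⧸ jacRad F A)

/-- The parameter `Par(A) = (d(A), n_A - 1)` of a finite dimensional algebra. -/
def par (A : FDHMA F H) : ℕ × ℕ :=
  (ssDim F A.carrier, nilIndex A.carrier - 1)

/-- The `H`-identities (in countably many variables) of a bundled algebra. -/
def FDHMA.ids (A : FDHMA F H) : Set (FreeHMA F H ℕ) :=
  A.M.idSet F H ℕ

/-- An `H`-basic algebra: not `H`-PI-equivalent to a finite direct product of finite
dimensional `H`-module algebras of strictly smaller parameter. -/
def IsHBasic (A : FDHMA F H) : Prop :=
  ¬ ∃ (s : ℕ) (B : Fin s → FDHMA F H),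
      (∀ i, toLex (par F H (B i)) < toLex (par F H A)) ∧
      A.ids F H = ⋂ i, (B i).ids F H

/-- The `H`-ideal of an `H`-module algebra generated by a set. -/
def hIdealSpan (M : HMA F H A) (s : Set A) : Submodule F A :=
  sInf {I : Submodule F A | s ⊆ I ∧ (∀ a : A, ∀ x ∈ I, a * x ∈ I ∧ x * a ∈ I) ∧
    (∀ h : H, ∀ x ∈ I, M.act h x ∈ I)}

/-! ### Abstract representation lemma -/

section Abstract
variable {K E : Type} [Field K] [AddCommGroup E] [Module K E] {n : ℕ}

/-- permutations supported on `X` -/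
def permsOn (X : Finset (Fin n)) : Finset (Equiv.Perm (Fin n)) :=
  Finset.univ.filter (fun σ => ∀ x, x ∉ X → σ x = x)

/-- the antisymmetrizer on `X` -/
def altOn (ρ : Equiv.Perm (Fin n) →* (E →ₗ[K] E)) (X : Finset (Fin n)) (v : E) : E :=
  ∑ σ ∈ permsOn X, ((Equiv.Perm.sign σ : ℤˣ) : ℤ) • ρ σ v

theorem altOn_add (ρ : Equiv.Perm (Fin n) →* (E →ₗ[K] E)) (X : Finset (Fin n)) (v w : E) :
    altOn ρ X (v + w) = altOn ρ X v + altOn ρ X w := by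
  simp [altOn, Finset.sum_add_distrib]

theorem altOn_sum (ρ : Equiv.Perm (Fin n) →* (E →ₗ[K] E)) (X : Finset (Fin n))
    {ι : Type} (s : Finset ι) (v : ι → E) :
    altOn ρ X (∑ i ∈ s, v i) = ∑ i ∈ s, altOn ρ X (v i) := by
  simp only [altOn, map_sum, Finset.smul_sum]
  rw [Finset.sum_comm]

theorem altOn_smul (ρ : Equiv.Perm (Fin n) →* (E →ₗ[K] E)) (X : Finset (Fin n)) (a : K) (v : E) :
    altOn ρ X (a • v) = a • altOn ρ X v := by
  simp only [altOn, map_smul, Finset.smul_sum]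
  exact Finset.sum_congr rfl fun σ _ => smul_comm _ _ _

theorem altOn_insert (ρ : Equiv.Perm (Fin n) →* (E →ₗ[K] E)) (X : Finset (Fin n)) (a : Fin n)
    (ha : a ∉ X) (v : E) :
    altOn ρ (insert a X) v = altOn ρ X (v + ∑ b ∈ X, (-1 : K) • ρ (Equiv.swap a b) v) := by
  have key : altOn ρ (insert a X) v
      = ∑ x ∈ permsOn X ×ˢ (insert a X),
        ((Equiv.Perm.sign (x.1 * Equiv.swap a x.2) : ℤˣ) : ℤ) • ρ (x.1 * Equiv.swap a x.2) v := by
    unfold altOn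
    refine Finset.sum_nbij' (fun σ => (σ * Equiv.swap a (σ⁻¹ a), σ⁻¹ a))
      (fun x => x.1 * Equiv.swap a x.2) ?_ ?_ ?_ ?_ ?_
    · intro σ hσ
      simp only [permsOn, Finset.mem_filter, Finset.mem_univ, true_and, Finset.mem_product] at hσ ⊢
      have hm : σ⁻¹ a ∈ insert a X := by
        by_contra h
        have h1 := hσ _ h
        have h2 : σ (σ⁻¹ a) = a := σ.apply_symm_apply a
        rw [h2] at h1
        rw [← h1] at h
        exact h (Finset.mem_insert_self _ _)
      refine ⟨?_, hm⟩
      intro x hx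
      by_cases hxa : x = a
      · subst hxa
        simp
      · have hx' : x ∉ insert a X := by simp [hxa, hx]
        have h2 : x ≠ σ⁻¹ a := fun h => hx' (h ▸ hm)
        rw [Equiv.Perm.mul_apply, Equiv.swap_apply_of_ne_of_ne hxa h2]
        exact hσ x hx'
    · rintro ⟨τ, b⟩ h
      simp only [permsOn, Finset.mem_filter, Finset.mem_univ, true_and, Finset.mem_product] at h ⊢
      intro x hx
      have hxa : x ≠ a := fun h' => hx (by simp [h'])
      have hxb : x ≠ b := fun h' => hx (h' ▸ h.2)
      rw [Equiv.Perm.mul_apply, Equiv.swap_apply_of_ne_of_ne hxa hxb]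
      exact h.1 x (fun h' => hx (Finset.mem_insert_of_mem h'))
    · intro σ _
      simp [mul_assoc]
    · rintro ⟨τ, b⟩ h
      simp only [permsOn, Finset.mem_filter, Finset.mem_univ, true_and, Finset.mem_product] at h ⊢
      have h1 : τ⁻¹ a = a := by rw [Equiv.Perm.inv_eq_iff_eq]; exact (h.1 a ha).symm
      have h2 : (τ * Equiv.swap a b)⁻¹ a = b := by
        rw [mul_inv_rev, Equiv.Perm.mul_apply, h1]; simp
      rw [h2]
      simp [mul_assoc]
    · intro σ _
      simp [mul_assoc]
  rw [key, Finset.sum_product]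
  unfold altOn
  refine Finset.sum_congr rfl fun τ _ => ?_
  rw [Finset.sum_insert ha]
  simp only [Equiv.swap_self, map_add, map_sum, smul_add, Finset.smul_sum]
  congr 1
  refine Finset.sum_congr rfl fun b hb => ?_
  have hab : a ≠ b := fun h => ha (h ▸ hb)
  simp [Equiv.Perm.sign_mul, Equiv.Perm.sign_swap hab]

theorem abstract_lemma [CharZero K] (ρ : Equiv.Perm (Fin n) →* (E →ₗ[K] E)) (V : Submodule K E)
    (hV : ∀ σ, ∀ v ∈ V, ρ σ v ∈ V) (hne : ∃ v ∈ V, v ≠ 0) (t : ℕ)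
    (hA : ∀ X : Finset (Fin n), X.card = t → ∀ v ∈ V, altOn ρ X v = 0) :
    ∃ c : Fin n → ℕ, (∀ x, c x < t - 1) ∧
      ∃ v ∈ V, v ≠ 0 ∧ ∀ σ : Equiv.Perm (Fin n), (∀ x, c (σ x) = c x) → ρ σ v = v := by
  classical
  let Q : (Fin n → ℕ) → Prop := fun c =>
    ∃ v ∈ V, v ≠ 0 ∧ ∀ σ : Equiv.Perm (Fin n), (∀ x, c (σ x) = c x) → ρ σ v = v
  have hex : ∃ m, ∃ c, Q c ∧ ∑ x, c x = m := by
    obtain ⟨v, hv, hv0⟩ := hne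
    refine ⟨_, fun x => x.val, ⟨v, hv, hv0, fun σ hσ => ?_⟩, rfl⟩
    have : σ = 1 := Equiv.ext fun x => Fin.ext (hσ x)
    simp [this]
  obtain ⟨c, ⟨v, hv, hv0, hfix⟩, hc⟩ := Nat.find_spec hex
  have hmin : ∀ c', Q c' → ∑ x, c x ≤ ∑ x, c' x := fun c' h' => by
    rw [hc]; exact Nat.find_min' hex ⟨c', h', rfl⟩
  have claim : ∀ a i, i < c a →
      ∑ b ∈ Finset.univ.filter (fun b => c b = i), ρ (Equiv.swap a b) v = -v := by
    intro a i hi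
    set B := insert a (Finset.univ.filter (fun b => c b = i)) with hB
    have haB : a ∉ Finset.univ.filter (fun b => c b = i) := by simp; omega
    set c' := Function.update c a i with hc'
    have hBc : ∀ x, x ∈ B ↔ c' x = i := by
      intro x
      by_cases hx : x = a
      · subst hx; simp [hB, hc']
      · simp [hB, hc', hx]
    set u := ∑ b ∈ B, ρ (Equiv.swap a b) v with hu
    have hu0 : u = 0 := by
      by_contra hne0
      have hQ : Q c' := by
        refine ⟨u, Submodule.sum_mem _ fun b _ => hV _ _ hv, hne0, ?_⟩
        intro σ hσ
        rw [hu, map_sum]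
        have hstep : ∀ b ∈ B, ρ σ (ρ (Equiv.swap a b) v) = ρ (Equiv.swap a (σ b)) v := by
          intro b hb
          set π := Equiv.swap a (σ b) * σ * Equiv.swap a b with hπ
          have hsw : ∀ d, c' d = i → ∀ x, c' (Equiv.swap a d x) = c' x := by
            intro d hd x
            have ha' : c' a = i := by simp [hc']
            rcases em (x = a) with h | h
            · subst h; simp [hd, ha']
            · by_cases h2 : x = d
              · subst h2; simp [hd, ha']
              · rw [Equiv.swap_apply_of_ne_of_ne h h2]
          have hcb : c' b = i := (hBc b).1 hb
          have hπc' : ∀ x, c' (π x) = c' x := by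
            intro x
            simp only [hπ, Equiv.Perm.mul_apply]
            rw [hsw _ (by rw [hσ]; exact hcb), hσ, hsw _ hcb]
          have hπa : π a = a := by simp [hπ]
          have hπc : ∀ x, c (π x) = c x := by
            intro x
            by_cases hx : x = a
            · rw [hx, hπa]
            · have h1 : π x ≠ a := fun h => hx (π.injective (h.trans hπa.symm))
              have h3 := hπc' x
              simpa [hc', hx, h1] using h3
          have h4 := hfix π hπc
          have h5 : σ * Equiv.swap a b = Equiv.swap a (σ b) * π := by
            simp [hπ, ← mul_assoc]
          rw [← Module.End.mul_apply, ← map_mul, h5, map_mul, Module.End.mul_apply, h4]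
        rw [Finset.sum_congr rfl hstep]
        refine Finset.sum_nbij' (fun b => σ b) (fun b => σ⁻¹ b) ?_ ?_ ?_ ?_ ?_
        · intro b hb
          rw [hBc] at hb ⊢; rw [hσ, hb]
        · intro b hb
          rw [hBc] at hb ⊢
          rw [← hσ (σ⁻¹ b)]; simpa using hb
        · intro b _; simp
        · intro b _; simp
        · intro b _; rfl
      have h1 := hmin c' hQ
      have h2 : ∑ x, c' x < ∑ x, c x := by
        refine Finset.sum_lt_sum (fun x _ => ?_) ⟨a, Finset.mem_univ _, by simpa [hc'] using hi⟩
        by_cases hx : x = a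
        · subst hx; simp [hc']; omega
        · simp [hc', hx]
      omega
    rw [hu, hB, Finset.sum_insert haB] at hu0
    simp only [Equiv.swap_self] at hu0
    have h1 : ρ (Equiv.refl (Fin n)) v = v := by
      have := map_one ρ
      exact congrArg (fun f => f v) this
    rw [h1] at hu0
    exact (neg_eq_of_add_eq_zero_right hu0).symm
  refine ⟨c, ?_, v, hv, hv0, hfix⟩
  by_contra hcon
  push Not at hcon
  obtain ⟨a, ha⟩ := hcon
  have hrow : ∀ i < t, (Finset.univ.filter (fun b => c b = i)).Nonempty := by
    intro i hi
    by_contra hemp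
    rw [Finset.not_nonempty_iff_eq_empty] at hemp
    by_cases h : c a = i
    · have : a ∈ Finset.univ.filter (fun b => c b = i) := by simp [h]
      rw [hemp] at this; simp at this
    · have h1 := claim a i (by omega)
      rw [hemp] at h1
      simp only [Finset.sum_empty] at h1
      exact hv0 (neg_eq_zero.mp h1.symm)
  have hind : ∀ d ≤ t, ∀ X : Finset (Fin n), X.card + d = t → (∀ x ∈ X, d ≤ c x) →
      altOn ρ X v = 0 := by
    intro d
    induction d with
    | zero => intro _ X hX _; exact hA X (by omega) v hv
    | succ d ih =>
      intro hd X hX hXc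
      have hbX : ∀ b, c b = d → b ∉ X := fun b hb h => by have := hXc b h; omega
      have h0 : ∑ b ∈ Finset.univ.filter (fun b => c b = d), altOn ρ (insert b X) v = 0 := by
        refine Finset.sum_eq_zero fun b hb => ?_
        have hb' : c b = d := by simpa using hb
        refine ih (by omega) _ (by rw [Finset.card_insert_of_notMem (hbX b hb')]; omega) ?_
        intro x hx
        rcases Finset.mem_insert.1 hx with h | h
        · subst h; omega
        · have := hXc x h; omega
      have h1 : ∑ b ∈ Finset.univ.filter (fun b => c b = d), altOn ρ (insert b X) v
          = altOn ρ X ((((Finset.univ.filter (fun b => c b = d)).card + X.card : ℕ) : K) • v) := by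
        rw [Finset.sum_congr rfl fun b hb =>
          altOn_insert ρ X b (hbX b (by simpa using hb)) v, ← altOn_sum]
        congr 1
        rw [Finset.sum_add_distrib, Finset.sum_comm]
        have h2 : ∀ x ∈ X, ∑ b ∈ Finset.univ.filter (fun b => c b = d),
            (-1 : K) • ρ (Equiv.swap b x) v = v := by
          intro x hx
          rw [← Finset.smul_sum]
          have := claim x d (by have := hXc x hx; omega)
          rw [Finset.sum_congr rfl fun b _ => by rw [Equiv.swap_comm b x], this]
          simp
        rw [Finset.sum_congr rfl h2]
        simp only [Finset.sum_const, Nat.cast_add, add_smul, Nat.cast_smul_eq_nsmul]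
      rw [h1, altOn_smul] at h0
      rcases smul_eq_zero.1 h0 with h | h
      · exfalso
        have hpos := Finset.card_pos.2 (hrow d (by omega))
        have : (Finset.univ.filter (fun b => c b = d)).card + X.card = 0 := by exact_mod_cast h
        omega
      · exact h
  have hfin := hind t le_rfl ∅ (by simp) (by simp)
  apply hv0
  have hpe : permsOn (∅ : Finset (Fin n)) = {1} := by
    ext σ
    simp only [permsOn, Finset.mem_filter, Finset.mem_univ, true_and, Finset.mem_singleton]
    constructor
    · intro h; exact Equiv.ext fun x => h x (by simp)
    · rintro rfl; simp
  simpa [altOn, hpe] using hfin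

end Abstract

/-! ### Forward direction: `id^H(W)` is a T-ideal -/

section Poly
set_option linter.unusedSectionVars false

/-- the twisted product `z ↦ (z₁·a)(z₂·b)` -/
def HMA.twist (M : HMA F H A) (z : H ⊗[F] H) (a b : A) : A :=
  (LinearMap.mul' F A) ((TensorProduct.map (TensorProduct.lift M.act) (TensorProduct.lift M.act))
    (TensorProduct.tensorTensorTensorComm F H H A A (z ⊗ₜ[F] (a ⊗ₜ[F] b))))

theorem HMA.act_mul_eq (M : HMA F H A) (h : H) (a b : A) :
    M.act h (a * b) = M.twist F H (Coalgebra.comul (R := F) h) a b := by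
  have := congrArg (fun φ => φ (h ⊗ₜ[F] (a ⊗ₜ[F] b))) M.act_mul_compat
  simpa [HMA.twist] using this

theorem HMA.twist_tmul (M : HMA F H A) (h k : H) (a b : A) :
    M.twist F H (h ⊗ₜ[F] k) a b = M.act h a * M.act k b := by
  simp [HMA.twist]

theorem HMA.twist_add (M : HMA F H A) (y z : H ⊗[F] H) (a b : A) :
    M.twist F H (y + z) a b = M.twist F H y a b + M.twist F H z a b := by
  simp [HMA.twist, TensorProduct.add_tmul]

theorem HMA.twist_zero (M : HMA F H A) (a b : A) :
    M.twist F H 0 a b = 0 := by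
  simp [HMA.twist]

theorem HMA.eval_ι (M : HMA F H A) (v : V → A) (p : V →₀ F) (h : H) :
    M.eval F H v (TensorAlgebra.ι F (p ⊗ₜ[F] h)) = M.act h (Finsupp.linearCombination F v p) := by
  simp [HMA.eval]

theorem substHom_ι (g : V → (V →₀ F)) (p : V →₀ F) (h : H) :
    substHom F H g (TensorAlgebra.ι F (p ⊗ₜ[F] h))
      = TensorAlgebra.ι F (Finsupp.linearCombination F g p ⊗ₜ[F] h) := by
  simp [substHom]

theorem free_hom_ext {B : Type} [Ring B] [Algebra F B] {f g : FreeHMA F H V →ₐ[F] B}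
    (hh : ∀ v h, f (TensorAlgebra.ι F (Finsupp.single v 1 ⊗ₜ[F] h))
      = g (TensorAlgebra.ι F (Finsupp.single v 1 ⊗ₜ[F] h))) : f = g := by
  apply TensorAlgebra.hom_ext
  apply TensorProduct.ext'
  intro p h
  induction p using Finsupp.induction_linear with
  | zero => simp
  | add p q hp hq => rw [TensorProduct.add_tmul, map_add, map_add, hp, hq]
  | single v a =>
    have h1 : (Finsupp.single v a : V →₀ F) = a • Finsupp.single v 1 := by simp
    rw [h1, ← TensorProduct.smul_tmul', map_smul, map_smul]
    congr 1
    exact hh v h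

theorem HMA.eval_act (M : HMA F H A) (𝔉 : HMA F H (FreeHMA F H V)) (hfree : IsFreeAction F H 𝔉)
    (v : V → A) (p : FreeHMA F H V) :
    ∀ h : H, M.eval F H v (𝔉.act h p) = M.act h (M.eval F H v p) := by
  induction p using TensorAlgebra.induction with
  | algebraMap r =>
    intro h
    rw [Algebra.algebraMap_eq_smul_one, map_smul (𝔉.act h), 𝔉.act_algebraOne, map_smul, map_smul,
      map_smul (M.eval F H v), map_smul (M.act h), map_one (M.eval F H v), M.act_algebraOne]
  | ι x =>
    intro h
    induction x using TensorProduct.induction_on with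
    | zero => simp
    | tmul p k => rw [hfree, HMA.eval_ι, HMA.eval_ι, M.act_mul]; rfl
    | add x y hx hy => simp only [map_add, hx, hy]
  | mul a b ha hb =>
    intro h
    rw [map_mul (M.eval F H v), 𝔉.act_mul_eq, M.act_mul_eq]
    generalize (Coalgebra.comul (R := F) h : H ⊗[F] H) = z
    induction z using TensorProduct.induction_on with
    | zero => simp [HMA.twist_zero]
    | tmul h k => rw [HMA.twist_tmul, HMA.twist_tmul, map_mul, ha, hb]
    | add x y hx hy => rw [HMA.twist_add, HMA.twist_add, map_add, hx, hy]
  | add a b ha hb => intro h; simp only [map_add, ha, hb]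

theorem HMA.eval_eval (M : HMA F H A) (𝔉 : HMA F H (FreeHMA F H V)) (hfree : IsFreeAction F H 𝔉)
    (v : V → A) (g : V → FreeHMA F H V) (f : FreeHMA F H V) :
    M.eval F H v (𝔉.eval F H g f) = M.eval F H (fun k => M.eval F H v (g k)) f := by
  have : (M.eval F H v).comp (𝔉.eval F H g) = M.eval F H (fun k => M.eval F H v (g k)) := by
    apply free_hom_ext
    intro k h
    simp only [AlgHom.comp_apply, HMA.eval_ι, Finsupp.linearCombination_single, one_smul]
    exact M.eval_act F H 𝔉 hfree v _ h
  exact congrArg (fun φ => φ f) this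

theorem HMA.eval_substHom (M : HMA F H A) (v : V → A) (g : V → (V →₀ F)) (f : FreeHMA F H V) :
    M.eval F H v (substHom F H g f)
      = M.eval F H (fun k => Finsupp.linearCombination F v (g k)) f := by
  have : (M.eval F H v).comp (substHom F H g)
      = M.eval F H (fun k => Finsupp.linearCombination F v (g k)) := by
    apply free_hom_ext
    intro k h
    simp only [AlgHom.comp_apply, HMA.eval_ι, substHom_ι, Finsupp.linearCombination_single,
      one_smul]
  exact congrArg (fun φ => φ f) this

theorem HMA.eval_free_lin (𝔉 : HMA F H (FreeHMA F H V)) (hfree : IsFreeAction F H 𝔉)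
    (g : V → (V →₀ F)) (f : FreeHMA F H V) :
    𝔉.eval F H (fun k => TensorAlgebra.ι F (g k ⊗ₜ[F] (1 : H))) f = substHom F H g f := by
  have : 𝔉.eval F H (fun k => TensorAlgebra.ι F (g k ⊗ₜ[F] (1 : H))) = substHom F H g := by
    apply free_hom_ext
    intro k h
    simp only [HMA.eval_ι, substHom_ι, Finsupp.linearCombination_single, one_smul]
    rw [hfree, mul_one]
  exact congrArg (fun φ => φ f) this

/-- renaming of variables -/
def ren (s : V → V) : FreeHMA F H V →ₐ[F] FreeHMA F H V :=
  substHom F H (fun v => Finsupp.single (s v) 1)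

theorem ren_ren (s s' : V → V) (f : FreeHMA F H V) :
    ren F H s (ren F H s' f) = ren F H (s ∘ s') f := by
  have : (ren F H s).comp (ren F H s') = ren F H (s ∘ s') := by
    apply free_hom_ext
    intro k h
    simp only [AlgHom.comp_apply, ren, substHom_ι, Finsupp.linearCombination_single, one_smul,
      Function.comp]
  exact congrArg (fun φ => φ f) this

theorem HMA.eval_ren (M : HMA F H A) (v : V → A) (s : V → V) (f : FreeHMA F H V) :
    M.eval F H v (ren F H s f) = M.eval F H (v ∘ s) f := by
  rw [ren, HMA.eval_substHom]
  congr 1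
  congr 1
  funext k
  simp

/-- identities as a submodule kernel: the evaluation map into functions -/
def HMA.Ev (M : HMA F H A) : FreeHMA F H V →ₗ[F] ((V → A) → A) :=
  LinearMap.pi (fun v => (M.eval F H v).toLinearMap)

theorem HMA.Ev_apply (M : HMA F H A) (f : FreeHMA F H V) (v : V → A) :
    M.Ev F H f v = M.eval F H v f := rfl

theorem HMA.mem_idSet (M : HMA F H A) (f : FreeHMA F H V) :
    f ∈ M.idSet F H V ↔ M.Ev F H f = 0 := by
  simp only [HMA.idSet, Set.mem_ofPred_eq, funext_iff, HMA.Ev_apply, Pi.zero_apply]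

theorem HMA.Ev_substHom (M : HMA F H A) (g : V → (V →₀ F)) (f : FreeHMA F H V)
    (hf : M.Ev F H f = 0) : M.Ev F H (substHom F H g f) = 0 := by
  funext v
  rw [HMA.Ev_apply, HMA.eval_substHom, ← HMA.Ev_apply, hf]; rfl

/-- The polynomials all of whose substitutions in `t-1` variables are identities. -/
def Gam (M : HMA F H A) (𝔉 : HMA F H (FreeHMA F H ℕ)) (t : ℕ) : Submodule F (FreeHMA F H ℕ) where
  carrier := {f | ∀ g : ℕ → FreeHMA F H ℕ,
    (∀ k, DependsOnlyOn F H (g k) {m : ℕ | m < t - 1}) → M.Ev F H (𝔉.eval F H g f) = 0}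
  add_mem' := by
    intro a b ha hb g hg
    rw [map_add, map_add, ha g hg, hb g hg, add_zero]
  zero_mem' := by intro g _; simp
  smul_mem' := by
    intro c a ha g hg
    rw [map_smul, map_smul, ha g hg, smul_zero]

theorem Gam_substHom (M : HMA F H A) (𝔉 : HMA F H (FreeHMA F H ℕ)) (t : ℕ) (f : FreeHMA F H ℕ)
    (hf : f ∈ Gam F H M 𝔉 t) (g : ℕ → (ℕ →₀ F)) : substHom F H g f ∈ Gam F H M 𝔉 t := by
  intro g' hg'
  rw [HMA.eval_substHom]
  apply hf
  intro k
  rw [Finsupp.linearCombination_apply]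
  exact Subalgebra.sum_mem _ fun i _ => Subalgebra.smul_mem _ (hg' i) _

theorem id_le_Gam (M : HMA F H A) (𝔉 : HMA F H (FreeHMA F H ℕ)) (hfree : IsFreeAction F H 𝔉)
    (t : ℕ) (f : FreeHMA F H ℕ)
    (hf : M.Ev F H f = 0) : f ∈ Gam F H M 𝔉 t := by
  intro g _
  funext v
  rw [HMA.Ev_apply, HMA.eval_eval F H M 𝔉 hfree, ← HMA.Ev_apply, hf]; rfl

/-! ### Monomials -/

/-- the monomial `x_{l 0}^{h 0} ⋯ x_{l (k-1)}^{h (k-1)}` -/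
def mon {k : ℕ} (h : Fin k → H) (l : Fin k → ℕ) : FreeHMA F H ℕ :=
  TensorAlgebra.tprod F _ k (fun p => Finsupp.single (l p) (1 : F) ⊗ₜ[F] h p)

theorem substHom_mon {k : ℕ} (h : Fin k → H) (l : Fin k → ℕ) (g : ℕ → (ℕ →₀ F)) :
    substHom F H g (mon F H h l)
      = TensorAlgebra.tprod F _ k (fun p => g (l p) ⊗ₜ[F] h p) := by
  simp only [mon, TensorAlgebra.tprod_apply, map_list_prod, List.map_ofFn, Function.comp_def,
    substHom_ι, Finsupp.linearCombination_single, one_smul]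

theorem ren_mon {k : ℕ} (h : Fin k → H) (l : Fin k → ℕ) (s : ℕ → ℕ) :
    ren F H s (mon F H h l) = mon F H h (s ∘ l) := by
  rw [ren, substHom_mon]; rfl

/-- polynomials of degree `k` -/
def Deg (k : ℕ) : Submodule F (FreeHMA F H ℕ) :=
  Submodule.span F {f | ∃ (h : Fin k → H) (l : Fin k → ℕ), f = mon F H h l}

/-- polynomials of degree `< N` -/
def DegLT (N : ℕ) : Submodule F (FreeHMA F H ℕ) :=
  Submodule.span F {f | ∃ k < N, ∃ (h : Fin k → H) (l : Fin k → ℕ), f = mon F H h l}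

/-- multilinear polynomials -/
def Pmul (n : ℕ) : Submodule F (FreeHMA F H ℕ) :=
  Submodule.span F {f | ∃ (h : Fin n → H) (σ : Equiv.Perm (Fin n)),
    f = mon F H h (fun p => (σ p).val)}

theorem DegLT_mono {N N' : ℕ} (hN : N ≤ N') : DegLT F H N ≤ DegLT F H N' := by
  apply Submodule.span_mono
  rintro f ⟨k, hk, h⟩
  exact ⟨k, hk.trans_le hN, h⟩

theorem adjoin_xvar : Algebra.adjoin F {x : FreeHMA F H ℕ | ∃ v, ∃ h : H, x = xvar F H v h} = ⊤ := by
  rw [eq_top_iff, ← TensorAlgebra.adjoin_range_ι, Algebra.adjoin_le_iff]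
  rintro _ ⟨x, rfl⟩
  simp only [SetLike.mem_coe]
  induction x using TensorProduct.induction_on with
  | zero => simp
  | add x y hx hy => rw [map_add]; exact Subalgebra.add_mem _ hx hy
  | tmul p h =>
    induction p using Finsupp.induction_linear with
    | zero => simp
    | add p q hp hq => rw [TensorProduct.add_tmul, map_add]; exact Subalgebra.add_mem _ hp hq
    | single v a =>
      have h1 : (Finsupp.single v a : ℕ →₀ F) = a • Finsupp.single v 1 := by simp
      rw [h1, ← TensorProduct.smul_tmul', map_smul]
      apply Subalgebra.smul_mem
      apply Algebra.subset_adjoin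
      exact ⟨v, h, rfl⟩

theorem exists_DegLT (f : FreeHMA F H ℕ) : ∃ N, f ∈ DegLT F H N := by
  have hf : f ∈ Subalgebra.toSubmodule
      (Algebra.adjoin F {x : FreeHMA F H ℕ | ∃ v, ∃ h : H, x = xvar F H v h}) := by
    rw [adjoin_xvar]; simp
  rw [Algebra.adjoin_eq_span] at hf
  induction hf using Submodule.span_induction with
  | zero => exact ⟨0, Submodule.zero_mem _⟩
  | add x y _ _ hx hy =>
    obtain ⟨N, hN⟩ := hx
    obtain ⟨N', hN'⟩ := hy
    exact ⟨max N N', Submodule.add_mem _ (DegLT_mono F H (le_max_left _ _) hN)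
      (DegLT_mono F H (le_max_right _ _) hN')⟩
  | smul a x _ hx =>
    obtain ⟨N, hN⟩ := hx
    exact ⟨N, Submodule.smul_mem _ _ hN⟩
  | mem x hx =>
    obtain ⟨L, hL, rfl⟩ := Submonoid.exists_list_of_mem_closure hx
    have hL' : ∀ i : Fin L.length, ∃ v, ∃ h : H, L.get i = xvar F H v h :=
      fun i => hL _ (List.get_mem L i)
    choose l h hlh using hL'
    refine ⟨L.length + 1, Submodule.subset_span ⟨L.length, by omega, h, l, ?_⟩⟩
    rw [mon, TensorAlgebra.tprod_apply]
    conv_lhs => rw [← List.ofFn_get L]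
    congr 1
    congr 1
    funext i
    exact hlh i

theorem DegLT_succ (N : ℕ) : DegLT F H (N + 1) ≤ DegLT F H N ⊔ Deg F H N := by
  apply Submodule.span_le.2
  rintro f ⟨k, hk, h, l, rfl⟩
  rcases Nat.lt_succ_iff_lt_or_eq.1 hk with hk | rfl
  · exact Submodule.mem_sup_left (Submodule.subset_span ⟨k, hk, h, l, rfl⟩)
  · exact Submodule.mem_sup_right (Submodule.subset_span ⟨h, l, rfl⟩)

/-! ### The linearization operator -/

/-- the substitution `x_l ↦ ∑_{s ∉ S, i s = l} y_s` -/
def linSub {n : ℕ} (i : Fin n → ℕ) (S : Finset (Fin n)) (l : ℕ) : ℕ →₀ F :=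
  ∑ s ∈ Finset.univ.filter (fun s => s ∉ S ∧ i s = l), Finsupp.single s.val 1

/-- the linearization operator -/
def Lin {n : ℕ} (i : Fin n → ℕ) (f : FreeHMA F H ℕ) : FreeHMA F H ℕ :=
  ∑ S : Finset (Fin n), ((-1 : ℤ) ^ S.card) • substHom F H (linSub F i S) f

theorem Lin_add {n : ℕ} (i : Fin n → ℕ) (f g : FreeHMA F H ℕ) :
    Lin F H i (f + g) = Lin F H i f + Lin F H i g := by
  simp [Lin, Finset.sum_add_distrib]

theorem Lin_zero {n : ℕ} (i : Fin n → ℕ) : Lin F H i 0 = 0 := by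
  simp [Lin]

theorem Lin_smul {n : ℕ} (i : Fin n → ℕ) (a : F) (f : FreeHMA F H ℕ) :
    Lin F H i (a • f) = a • Lin F H i f := by
  simp only [Lin, map_smul, Finset.smul_sum]
  exact Finset.sum_congr rfl fun σ _ => smul_comm _ _ _

theorem Lin_mem_Gam (M : HMA F H A) (𝔉 : HMA F H (FreeHMA F H ℕ)) (t : ℕ) (f : FreeHMA F H ℕ)
    (hf : f ∈ Gam F H M 𝔉 t) {n : ℕ} (i : Fin n → ℕ) : Lin F H i f ∈ Gam F H M 𝔉 t :=
  Submodule.sum_mem _ fun _ _ => zsmul_mem (Gam_substHom F H M 𝔉 t f hf _) _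

theorem Ev_Lin (M : HMA F H A) (f : FreeHMA F H ℕ)
    (hf : M.Ev F H f = 0) {n : ℕ} (i : Fin n → ℕ) : M.Ev F H (Lin F H i f) = 0 := by
  rw [Lin, map_sum]
  refine Finset.sum_eq_zero fun S _ => ?_
  rw [map_zsmul, M.Ev_substHom F H _ f hf, smul_zero]

open Classical in
theorem Lin_mon {n k : ℕ} (i : Fin n → ℕ) (h : Fin k → H) (l : Fin k → ℕ) :
    Lin F H i (mon F H h l)
      = ∑ τ : Fin k → Fin n, if Function.Surjective τ ∧ (∀ p, i (τ p) = l p) then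
          mon F H h (fun p => (τ p).val) else 0 := by
  have h1 : ∀ S : Finset (Fin n), substHom F H (linSub F i S) (mon F H h l)
      = ∑ τ : Fin k → Fin n, if (∀ p, τ p ∉ S) ∧ (∀ p, i (τ p) = l p) then
          mon F H h (fun p => (τ p).val) else 0 := by
    intro S
    rw [substHom_mon]
    simp only [linSub, TensorProduct.sum_tmul]
    rw [MultilinearMap.map_sum_finset, ← Finset.sum_filter]
    refine Finset.sum_congr ?_ fun _ _ => rfl
    ext τ
    simp [Fintype.mem_piFinset, forall_and]
  unfold Lin
  simp only [h1, Finset.smul_sum]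
  rw [Finset.sum_comm]
  refine Finset.sum_congr rfl fun τ _ => ?_
  by_cases hτ : ∀ p, i (τ p) = l p
  · simp only [hτ, implies_true, and_true]
    have h2 : ∀ S : Finset (Fin n), ((-1 : ℤ) ^ S.card) •
        (if (∀ p, τ p ∉ S) then mon F H h (fun p => (τ p).val) else 0)
        = (if S ∈ (Finset.univ.image τ)ᶜ.powerset then (-1 : ℤ) ^ S.card else 0) •
          mon F H h (fun p => (τ p).val) := by
      intro S
      have : S ∈ (Finset.univ.image τ)ᶜ.powerset ↔ ∀ p, τ p ∉ S := by
        simp only [Finset.mem_powerset, Finset.subset_iff, Finset.mem_compl, Finset.mem_image,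
          Finset.mem_univ, true_and, not_exists]
        constructor
        · intro h p hp; exact h hp p rfl
        · rintro h x hx p rfl; exact h p hx
      simp only [this]
      split_ifs <;> simp
    rw [Finset.sum_congr rfl fun S _ => h2 S, ← Finset.sum_smul, ← Finset.sum_filter]
    have h3 : (Finset.univ.filter (fun S => S ∈ (Finset.univ.image τ)ᶜ.powerset))
        = (Finset.univ.image τ)ᶜ.powerset := by ext; simp
    rw [h3, Finset.sum_powerset_neg_one_pow_card]
    have h4 : (Finset.univ.image τ)ᶜ = ∅ ↔ Function.Surjective τ := by
      rw [Finset.compl_eq_empty_iff, Finset.eq_univ_iff_forall]; simp [Function.Surjective]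
    simp only [h4]
    split_ifs <;> simp
  · simp [hτ]

end Poly

section Final
set_option linter.unusedSectionVars false

/-- extend a permutation of `Fin n` to `ℕ` -/
def extP {n : ℕ} : Equiv.Perm (Fin n) →* Equiv.Perm ℕ :=
  Equiv.Perm.extendDomainHom Fin.equivSubtype

theorem extP_val {n : ℕ} (σ : Equiv.Perm (Fin n)) (x : Fin n) : extP σ x.val = (σ x).val :=
  Equiv.Perm.extendDomain_apply_image σ Fin.equivSubtype x

theorem extP_ge {n : ℕ} (σ : Equiv.Perm (Fin n)) (x : ℕ) (hx : ¬ x < n) : extP σ x = x :=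
  Equiv.Perm.extendDomain_apply_not_subtype σ Fin.equivSubtype hx

theorem extP_swap {n : ℕ} (i j : Fin n) : extP (Equiv.swap i j) = Equiv.swap i.val j.val := by
  apply Equiv.ext
  intro x
  by_cases hx : x < n
  · have h := extP_val (Equiv.swap i j) ⟨x, hx⟩
    simp only at h
    rw [h]
    simp only [Equiv.swap_apply_def, Fin.ext_iff]
    split_ifs <;> rfl
  · rw [extP_ge _ _ hx, Equiv.swap_apply_of_ne_of_ne] <;> omega

/-- extend a function on `Fin n` to `ℕ` -/
def extF {n : ℕ} (c : Fin n → ℕ) (k : ℕ) : ℕ := if hk : k < n then c ⟨k, hk⟩ else 0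

theorem extF_val {n : ℕ} (c : Fin n → ℕ) (x : Fin n) : extF c x.val = c x := by
  simp [extF]

open Classical in
theorem Lin_mon_perm {n : ℕ} (i : Fin n → ℕ) (h : Fin n → H) (l : Fin n → ℕ) :
    Lin F H i (mon F H h l)
      = ∑ σ : Equiv.Perm (Fin n), if ∀ p, i (σ p) = l p then
          mon F H h (fun p => (σ p).val) else 0 := by
  rw [Lin_mon, ← Finset.sum_filter, ← Finset.sum_filter]
  symm
  refine Finset.sum_bij (fun σ _ => ⇑σ) ?_ ?_ ?_ ?_
  · intro σ hσ
    simp only [Finset.mem_filter, Finset.mem_univ, true_and] at hσ ⊢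
    exact ⟨σ.surjective, hσ⟩
  · intro σ _ τ _ hh
    exact DFunLike.coe_injective hh
  · intro τ hτ
    simp only [Finset.mem_filter, Finset.mem_univ, true_and] at hτ
    exact ⟨Equiv.ofBijective τ ⟨Finite.injective_iff_surjective.2 hτ.1, hτ.1⟩,
      Finset.mem_filter.2 ⟨Finset.mem_univ _, hτ.2⟩, rfl⟩
  · intro σ _; rfl

theorem Lin_mem_Pmul {n : ℕ} (i : Fin n → ℕ) (f : FreeHMA F H ℕ) (hf : f ∈ Deg F H n) :
    Lin F H i f ∈ Pmul F H n := by
  induction hf using Submodule.span_induction with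
  | zero => rw [Lin_zero]; exact Submodule.zero_mem _
  | add x y _ _ hx hy => rw [Lin_add]; exact Submodule.add_mem _ hx hy
  | smul a x _ hx => rw [Lin_smul]; exact Submodule.smul_mem _ _ hx
  | mem x hx =>
    obtain ⟨h, l, rfl⟩ := hx
    rw [Lin_mon_perm]
    refine Submodule.sum_mem _ fun σ _ => ?_
    split_ifs
    · exact Submodule.subset_span ⟨h, σ, rfl⟩
    · exact Submodule.zero_mem _

theorem Lin_DegLT {n : ℕ} (i : Fin n → ℕ) (f : FreeHMA F H ℕ) (hf : f ∈ DegLT F H n) :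
    Lin F H i f = 0 := by
  induction hf using Submodule.span_induction with
  | zero => rw [Lin_zero]
  | add x y _ _ hx hy => rw [Lin_add, hx, hy, add_zero]
  | smul a x _ hx => rw [Lin_smul, hx, smul_zero]
  | mem x hx =>
    obtain ⟨k, hk, h, l, rfl⟩ := hx
    rw [Lin_mon]
    refine Finset.sum_eq_zero fun τ _ => if_neg fun hτ => ?_
    have := Fintype.card_le_of_surjective τ hτ.1
    simp at this
    omega

theorem restitution {n : ℕ} (f : FreeHMA F H ℕ) (hf : f ∈ Deg F H n) :
    ∃ m, ∀ m' ≥ m, (n.factorial : F) • f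
      = ∑ i : Fin n → Fin m', ren F H (extF (fun x => (i x).val)) (Lin F H (fun x => (i x).val) f) := by
  classical
  induction hf using Submodule.span_induction with
  | zero => exact ⟨0, fun m' _ => by simp [Lin_zero]⟩
  | add x y _ _ hx hy =>
    obtain ⟨m₁, h₁⟩ := hx
    obtain ⟨m₂, h₂⟩ := hy
    refine ⟨max m₁ m₂, fun m' hm' => ?_⟩
    rw [smul_add, h₁ m' (le_trans (le_max_left _ _) hm'), h₂ m' (le_trans (le_max_right _ _) hm'),
      ← Finset.sum_add_distrib]
    simp only [Lin_add, map_add]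
  | smul a x _ hx =>
    obtain ⟨m, hm⟩ := hx
    refine ⟨m, fun m' hm' => ?_⟩
    rw [smul_comm, hm m' hm', Finset.smul_sum]
    simp only [Lin_smul, map_smul]
  | mem x hx =>
    obtain ⟨h, l, rfl⟩ := hx
    refine ⟨∑ p, l p + 1, fun m' hm' => ?_⟩
    have hl : ∀ p, l p < m' := fun p => by
      have := Finset.single_le_sum (f := l) (fun _ _ => Nat.zero_le _) (Finset.mem_univ p)
      omega
    have h1 : ∀ i : Fin n → Fin m',
        ren F H (extF (fun x => (i x).val)) (Lin F H (fun x => (i x).val) (mon F H h l))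
        = ∑ σ : Equiv.Perm (Fin n), if i = (fun p => ⟨l (σ⁻¹ p), hl _⟩) then mon F H h l else 0 := by
      intro i
      rw [Lin_mon_perm, map_sum]
      refine Finset.sum_congr rfl fun σ _ => ?_
      have h2 : (∀ p, (i (σ p)).val = l p) ↔ i = (fun p => ⟨l (σ⁻¹ p), hl _⟩) := by
        constructor
        · intro hh
          funext p
          apply Fin.ext
          have := hh (σ⁻¹ p)
          rw [show σ (σ⁻¹ p) = p from σ.apply_symm_apply p] at this
          exact this
        · intro hh p
          rw [hh]
          simp only
          rw [show σ⁻¹ (σ p) = p from σ.symm_apply_apply p]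
      by_cases hh : ∀ p, (i (σ p)).val = l p
      · rw [if_pos hh, if_pos (h2.1 hh), ren_mon]
        congr 1
        funext p
        simp only [Function.comp, extF_val]
        exact hh p
      · rw [if_neg hh, if_neg (fun h3 => hh (h2.2 h3)), map_zero]
    rw [Finset.sum_congr rfl fun i _ => h1 i, Finset.sum_comm]
    simp only [Finset.sum_ite_eq', Finset.mem_univ, if_true, Finset.sum_const, Finset.card_univ,
      Fintype.card_perm, Fintype.card_fin, Nat.cast_smul_eq_nsmul]

theorem Pmul_multilinear {n : ℕ} (f : FreeHMA F H ℕ) (hf : f ∈ Pmul F H n) :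
    MultilinearOn F H (Finset.range n) (Finset.range n) f := by
  refine ⟨?_, subset_rfl, ?_⟩
  · unfold DependsOnlyOn
    induction hf using Submodule.span_induction with
    | zero => exact Subalgebra.zero_mem _
    | add x y _ _ hx hy => exact Subalgebra.add_mem _ hx hy
    | smul a x _ hx => exact Subalgebra.smul_mem _ hx _
    | mem x hx =>
      obtain ⟨h, σ, rfl⟩ := hx
      rw [mon, TensorAlgebra.tprod_apply]
      apply Subalgebra.list_prod_mem
      intro y hy
      rw [List.mem_ofFn] at hy
      obtain ⟨p, rfl⟩ := hy
      apply Algebra.subset_adjoin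
      exact ⟨(σ p).val, by simp, h p, rfl⟩
  · intro i hi y hy α
    have hi' : i < n := by simpa using hi
    induction hf using Submodule.span_induction with
    | zero => simp
    | add x z _ _ hx hz => rw [map_add, map_add, hx, hz, smul_add]; abel
    | smul a x _ hx => rw [map_smul, map_smul, hx, smul_add, smul_comm]
    | mem x hx =>
      obtain ⟨h, σ, rfl⟩ := hx
      unfold renameSubst
      rw [substHom_mon, substHom_mon, mon]
      obtain ⟨p0, hp0⟩ := σ.surjective ⟨i, hi'⟩
      have key : ∀ u : ℕ →₀ F, (fun p => (Function.update (fun v => Finsupp.single v (1 : F)) i u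
          ((σ p).val)) ⊗ₜ[F] h p)
          = Function.update (fun p => Finsupp.single ((σ p).val) (1 : F) ⊗ₜ[F] h p) p0
              (u ⊗ₜ[F] h p0) := by
        intro u
        funext p
        by_cases hp : p = p0
        · subst hp; simp [hp0]
        · have : (σ p).val ≠ i := fun hh => hp (σ.injective (by rw [hp0]; exact Fin.ext hh))
          simp [hp, this]
      rw [key, key, TensorProduct.add_tmul, MultilinearMap.map_update_add,
        ← TensorProduct.smul_tmul', MultilinearMap.map_update_smul]
      congr 2
      congr 1
      funext p
      by_cases hp : p = p0
      · subst hp; simp [hp0]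
      · simp [hp]

theorem Pmul_ren {n : ℕ} (f : FreeHMA F H ℕ) (hf : f ∈ Pmul F H n) (σ : Equiv.Perm (Fin n)) :
    ren F H (extP σ) f ∈ Pmul F H n := by
  induction hf using Submodule.span_induction with
  | zero => simp
  | add x z _ _ hx hz => rw [map_add]; exact Submodule.add_mem _ hx hz
  | smul a x _ hx => rw [map_smul]; exact Submodule.smul_mem _ _ hx
  | mem x hx =>
    obtain ⟨h, τ, rfl⟩ := hx
    rw [ren_mon]
    refine Submodule.subset_span ⟨h, σ * τ, ?_⟩
    congr 1
    funext p
    simp [extP_val]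

/-- the antisymmetrization of a polynomial -/
def altPoly {n : ℕ} (X : Finset (Fin n)) (f : FreeHMA F H ℕ) : FreeHMA F H ℕ :=
  ∑ σ ∈ permsOn X, ((Equiv.Perm.sign σ : ℤˣ) : ℤ) • ren F H (extP σ) f

theorem altPoly_alternating {n : ℕ} (X : Finset (Fin n)) (f : FreeHMA F H ℕ) :
    AlternatingOn F H (X.map Fin.valEmbedding) (altPoly F H X f) := by
  intro i hi j hj hij
  rw [Finset.mem_map] at hi hj
  obtain ⟨i, hi, rfl⟩ := hi
  obtain ⟨j, hj, rfl⟩ := hj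
  have hij' : i ≠ j := fun h => hij (by rw [h])
  have h0 : swapSubst F H (Fin.valEmbedding i) (Fin.valEmbedding j)
      = ren F H (extP (Equiv.swap i j)) := by
    rw [extP_swap]; rfl
  rw [h0, altPoly, map_sum, ← Finset.sum_neg_distrib]
  refine Finset.sum_nbij' (fun σ => Equiv.swap i j * σ) (fun σ => Equiv.swap i j * σ) ?_ ?_ ?_ ?_ ?_
  · intro σ hσ
    simp only [permsOn, Finset.mem_filter, Finset.mem_univ, true_and] at hσ ⊢
    intro x hx
    rw [Equiv.Perm.mul_apply, hσ x hx, Equiv.swap_apply_of_ne_of_ne]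
    · rintro rfl; exact hx hi
    · rintro rfl; exact hx hj
  · intro σ hσ
    simp only [permsOn, Finset.mem_filter, Finset.mem_univ, true_and] at hσ ⊢
    intro x hx
    rw [Equiv.Perm.mul_apply, hσ x hx, Equiv.swap_apply_of_ne_of_ne]
    · rintro rfl; exact hx hi
    · rintro rfl; exact hx hj
  · intro σ _; simp [← mul_assoc]
  · intro σ _; simp [← mul_assoc]
  · intro σ _
    rw [map_zsmul, ren_ren, ← Equiv.Perm.coe_mul, ← map_mul, Equiv.Perm.sign_mul,
      Equiv.Perm.sign_swap hij']
    simp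

/-- permutation action on functions -/
def funRep (n : ℕ) : Equiv.Perm (Fin n) →* (((ℕ → A) → A) →ₗ[F] ((ℕ → A) → A)) where
  toFun σ := LinearMap.funLeft F A (fun v : ℕ → A => v ∘ extP σ)
  map_one' := by
    ext φ v
    simp [LinearMap.funLeft]
  map_mul' σ τ := by
    ext φ v
    simp [LinearMap.funLeft, Function.comp_assoc]

theorem Ev_ren (M : HMA F H A) {n : ℕ} (σ : Equiv.Perm (Fin n)) (f : FreeHMA F H ℕ) :
    M.Ev F H (ren F H (extP σ) f) = funRep F n σ (M.Ev F H f) := by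
  funext v
  rw [HMA.Ev_apply, HMA.eval_ren]; rfl

open Classical in
theorem Lin_identify {n : ℕ} (c : Fin n → ℕ) (f : FreeHMA F H ℕ) (hf : f ∈ Pmul F H n) :
    Lin F H c (substHom F H (fun k => if hk : k < n then Finsupp.single (c ⟨k, hk⟩) 1 else 0) f)
      = ∑ σ ∈ Finset.univ.filter (fun σ : Equiv.Perm (Fin n) => ∀ x, c (σ x) = c x),
          ren F H (extP σ) f := by
  induction hf using Submodule.span_induction with
  | zero => simp [Lin_zero]
  | add x z _ _ hx hz => rw [map_add, Lin_add, hx, hz, ← Finset.sum_add_distrib]; simp only [map_add]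
  | smul a x _ hx => rw [map_smul, Lin_smul, hx, Finset.smul_sum]; simp only [map_smul]
  | mem x hx =>
    obtain ⟨h, τ, rfl⟩ := hx
    have h1 : substHom F H (fun k => if hk : k < n then Finsupp.single (c ⟨k, hk⟩) 1 else 0)
        (mon F H h (fun p => (τ p).val)) = mon F H h (fun p => c (τ p)) := by
      rw [substHom_mon, mon]
      simp
    rw [h1, Lin_mon_perm, ← Finset.sum_filter]
    simp only [ren_mon]
    refine Finset.sum_nbij' (fun σ => σ * τ⁻¹) (fun σ => σ * τ) ?_ ?_ ?_ ?_ ?_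
    · intro σ hσ
      simp only [Finset.mem_filter, Finset.mem_univ, true_and] at hσ ⊢
      intro x
      have := hσ (τ⁻¹ x)
      rw [show τ (τ⁻¹ x) = x from τ.apply_symm_apply x] at this
      exact this
    · intro σ hσ
      simp only [Finset.mem_filter, Finset.mem_univ, true_and] at hσ ⊢
      intro x
      exact hσ (τ x)
    · intro σ _; simp
    · intro σ _; simp
    · intro σ _
      congr 1
      funext p
      simp only [Function.comp, extP_val]
      simp

theorem multilinear_case [CharZero F] (M : HMA F H A) (t : ℕ)
    (hcap : SatisfiesCapelli F H (M.idSet F H ℕ) t)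
    (𝔉 : HMA F H (FreeHMA F H ℕ)) (hfree : IsFreeAction F H 𝔉) {n : ℕ}
    (f : FreeHMA F H ℕ) (hf : f ∈ Pmul F H n) (hfG : f ∈ Gam F H M 𝔉 t) :
    M.Ev F H f = 0 := by
  classical
  by_contra hne
  obtain ⟨c, hc, φ, hφ, hφ0, hfix⟩ := abstract_lemma (funRep F n)
    ((Pmul F H n ⊓ Gam F H M 𝔉 t).map (M.Ev F H)) (by
      rintro σ _ ⟨p, hp, rfl⟩
      exact ⟨ren F H (extP σ) p, ⟨Pmul_ren F H p hp.1 σ, Gam_substHom F H M 𝔉 t p hp.2 _⟩,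
        Ev_ren F H M σ p⟩)
    ⟨_, ⟨f, ⟨hf, hfG⟩, rfl⟩, hne⟩ t (by
      rintro X hX _ ⟨p, hp, rfl⟩
      have h1 : altOn (funRep F n) X (M.Ev F H p) = M.Ev F H (altPoly F H X p) := by
        simp only [altOn, altPoly, map_sum, map_zsmul, Ev_ren]
      rw [h1, ← HMA.mem_idSet]
      refine hcap _ (Finset.range n) (X.map Fin.valEmbedding) ?_ ?_ (by simpa using hX)
        (altPoly_alternating F H X p)
      · exact Pmul_multilinear F H _ (Submodule.sum_mem _ fun σ _ =>
          zsmul_mem (Pmul_ren F H p hp.1 σ) _)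
      · intro x hx
        rw [Finset.mem_map] at hx
        obtain ⟨y, _, rfl⟩ := hx
        simp)
  obtain ⟨p, ⟨hpP, hpG⟩, rfl⟩ := hφ
  have h1 : M.Ev F H (substHom F H
      (fun k => if hk : k < n then Finsupp.single (c ⟨k, hk⟩) 1 else 0) p) = 0 := by
    rw [← HMA.eval_free_lin F H 𝔉 hfree]
    apply hpG
    intro k
    by_cases hk : k < n
    · simp only [hk, dite_true]
      exact Algebra.subset_adjoin (show _ ∈ {x : FreeHMA F H ℕ | _} from ⟨c ⟨k, hk⟩, hc _, 1, rfl⟩)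
    · simp only [hk, dite_false, TensorProduct.zero_tmul, map_zero]
      exact Subalgebra.zero_mem _
  have h2 := Ev_Lin F H M _ h1 c
  rw [Lin_identify F H c p hpP, map_sum, Finset.sum_congr rfl (fun σ hσ => by
    rw [Ev_ren, hfix σ (by simpa using hσ)]), Finset.sum_const, ← Nat.cast_smul_eq_nsmul F] at h2
  rcases smul_eq_zero.1 h2 with h | h
  · have h3 := Finset.card_eq_zero.1 (Nat.cast_eq_zero.1 h)
    have h4 : (1 : Equiv.Perm (Fin n)) ∈
      Finset.univ.filter (fun σ : Equiv.Perm (Fin n) => ∀ x, c (σ x) = c x) := by simp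
    rw [h3] at h4
    simp at h4
  · exact hφ0 h

theorem general_case [CharZero F] (M : HMA F H A) (t : ℕ)
    (hcap : SatisfiesCapelli F H (M.idSet F H ℕ) t)
    (𝔉 : HMA F H (FreeHMA F H ℕ)) (hfree : IsFreeAction F H 𝔉) (N : ℕ) :
    ∀ f ∈ DegLT F H N, f ∈ Gam F H M 𝔉 t → M.Ev F H f = 0 := by
  induction N with
  | zero =>
    intro f hf _
    have : DegLT F H 0 = ⊥ := by
      rw [DegLT, Submodule.span_eq_bot]
      rintro x ⟨k, hk, _⟩
      omega
    rw [this, Submodule.mem_bot] at hf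
    rw [hf, map_zero]
  | succ N ih =>
    intro f hf hfG
    obtain ⟨f1, hf1, f2, hf2, rfl⟩ := Submodule.mem_sup.1 (DegLT_succ F H N hf)
    have h2 : M.Ev F H f2 = 0 := by
      have hL : ∀ i : Fin N → ℕ, M.Ev F H (Lin F H i f2) = 0 := by
        intro i
        have := Lin_mem_Gam F H M 𝔉 t _ hfG i
        rw [Lin_add, Lin_DegLT F H i f1 hf1, zero_add] at this
        exact multilinear_case F H M t hcap 𝔉 hfree _ (Lin_mem_Pmul F H i f2 hf2) this
      obtain ⟨m, hm⟩ := restitution F H f2 hf2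
      have h3 := congrArg (M.Ev F H) (hm m le_rfl)
      rw [map_smul, map_sum, Finset.sum_eq_zero (fun i _ => by
        rw [ren]; exact M.Ev_substHom F H _ _ (hL _))] at h3
      exact (smul_eq_zero.1 h3).resolve_left (Nat.cast_ne_zero.2 (Nat.factorial_ne_zero N))
    have h1 : f1 ∈ Gam F H M 𝔉 t := by
      have := Submodule.sub_mem _ hfG (id_le_Gam F H M 𝔉 hfree t f2 h2)
      simpa using this
    rw [map_add, h2, ih f1 hf1 h1, add_zero]

end Final

/-- Let `W` be an `H`-module algebra satisfying the `t`-th Capelli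
identity.  Then the relatively free `H`-module algebra `𝒲` of `W` on `t - 1`
generators, `𝒲 = F^H⟨x₁,...,x_{t-1}⟩/(id^H(W) ∩ F^H⟨x₁,...,x_{t-1}⟩)`, satisfies
`id^H(𝒲) = id^H(W)`.  Equivalently (identities of a relatively free algebra):
`f ∈ id^H(W)` if and only if every substitution of the variables of `f` by
`H`-polynomials in the variables `x₀, ..., x_{t-2}` lands in `id^H(W)`. -/
theorem relatively_free_on_capelli_many_generators
    (F : Type) [Field F] [CharZero F] (H : Type) [Ring H] [HopfAlgebra F H]
    [FiniteDimensional F H] [IsSemisimpleRing H]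
    (W : Type) [Ring W] [Algebra F W] (M : HMA F H W)
    (t : ℕ) (hcap : SatisfiesCapelli F H (M.idSet F H ℕ) t)
    (𝔉 : HMA F H (FreeHMA F H ℕ)) (hfree : IsFreeAction F H 𝔉) :
    ∀ f : FreeHMA F H ℕ,
      f ∈ M.idSet F H ℕ ↔
        ∀ g : ℕ → FreeHMA F H ℕ,
          (∀ k, DependsOnlyOn F H (g k) {m : ℕ | m < t - 1}) →
          𝔉.eval F H g f ∈ M.idSet F H ℕ := by
  intro f
  have hG : (∀ g : ℕ → FreeHMA F H ℕ,
          (∀ k, DependsOnlyOn F H (g k) {m : ℕ | m < t - 1}) →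
          𝔉.eval F H g f ∈ M.idSet F H ℕ) ↔ f ∈ Gam F H M 𝔉 t := by
    simp only [HMA.mem_idSet]
    rfl
  rw [hG, HMA.mem_idSet]
  constructor
  · exact id_le_Gam F H M 𝔉 hfree t f
  · intro h
    obtain ⟨N, hN⟩ := exists_DegLT F H f
    exact general_case F H M t hcap 𝔉 hfree N f hN h
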